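/- Let τ > 0, λ ≥ 0, and let (x_i, y_i) ∈ ℝ^p × ℝ for i = 1,…,n with each ‖x_i‖₂ < ∞. Define L(β) = (1/n)∑_{i=1}^n ℓ_τ(y_i − x_iᵀβ). Let β^{(t)} be MM iterates where each β^{(t+1)} is an exact minimizer of Q^{(t)}(β) = (1/(2n))∑_{i=1}^n v_i^{(t)}(y_i − x_iᵀβ)² + λ‖β‖₁ with v_i^{(t)} = exp(−(τ/2)(y_i − x_iᵀβ^{(t)})²). Then every limit point β* of the sequence {β^{(t)}} is a stationary point of F = L + λ‖·‖₁ in the subgradient sense: 0 ∈ ∇L(β*) + λ ∂‖β*‖₁, i.e., −∇L(β*) is a subgradient at β* of the convex function β ↦ λ‖β‖₁. -/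

import Mathlib

open scoped BigOperators RealInnerProductSpace

/-- Tangent-line majorization of the exponential loss, in the variable `r ^ 2`. -/
theorem expLoss_le_tangent {τ : ℝ} (hτ : 0 < τ) (r s : ℝ) :
    (1 / τ) * (1 - Real.exp (-(τ * r ^ 2 / 2))) ≤
      (1 / τ) * (1 - Real.exp (-(τ * s ^ 2 / 2))) +
        (1 / 2) * (Real.exp (-(τ / 2) * s ^ 2) * (r ^ 2 - s ^ 2)) := by
  have hexp : Real.exp (-(τ * r ^ 2 / 2)) =
      Real.exp (-(τ / 2) * s ^ 2) * Real.exp (-(τ / 2) * (r ^ 2 - s ^ 2)) := by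
    rw [← Real.exp_add]
    ring_nf
  have hs : -(τ * s ^ 2 / 2) = -(τ / 2) * s ^ 2 := by ring
  have h := mul_le_mul_of_nonneg_left (Real.add_one_le_exp (-(τ / 2) * (r ^ 2 - s ^ 2)))
    (Real.exp_pos (-(τ / 2) * s ^ 2)).le
  rw [← hexp] at h
  rw [hs]
  have h' := mul_le_mul_of_nonneg_left h (one_div_pos.2 hτ).le
  have hcancel : (1 / τ) * (Real.exp (-(τ / 2) * s ^ 2) * (-(τ / 2) * (r ^ 2 - s ^ 2) + 1)) =
      (1 / τ) * Real.exp (-(τ / 2) * s ^ 2) -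
        (1 / 2) * (Real.exp (-(τ / 2) * s ^ 2) * (r ^ 2 - s ^ 2)) := by
    field_simp
    ring
  rw [hcancel] at h'
  linarith

/-- A cluster point of majorize-minimize iterates minimizes the majorizer anchored at it. -/
theorem MapClusterPt.le_majorizer {E : Type*} [TopologicalSpace E] {F : E → ℝ} {G : E → E → ℝ}
    {B : ℕ → E} {b : E} (hF : Continuous F) (hG : ∀ z, Continuous fun a => G a z)
    (hmaj : ∀ a z, F z ≤ G a z) (htight : ∀ a, G a a = F a)
    (hmin : ∀ t z, G (B t) (B (t + 1)) ≤ G (B t) z)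
    (hb : MapClusterPt b Filter.atTop B) (z : E) : F b ≤ G b z := by
  have hanti : Antitone fun t => F (B t) :=
    antitone_nat_of_succ_le fun t =>
      (hmaj _ _).trans ((hmin t (B t)).trans (htight _).le)
  have hlower (t : ℕ) : F b ≤ F (B t) := by
    by_contra! hlt
    obtain ⟨s, hs, hts⟩ :=
      ((hb.frequently (hF.continuousAt.eventually (lt_mem_nhds hlt))).and_eventually
        (Filter.eventually_ge_atTop t)).exists
    exact (hanti hts).not_gt hs
  by_contra! hlt
  obtain ⟨t, ht⟩ :=
    (hb.frequently ((hG z).continuousAt.eventually (gt_mem_nhds hlt))).exists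
  exact ht.not_ge ((hlower (t + 1)).trans ((hmaj _ _).trans (hmin t z)))

theorem nonneg_of_forall_add_mul_nonneg {a c : ℝ}
    (h : ∀ s : ℝ, 0 < s → s ≤ 1 → 0 ≤ a + s * c) : 0 ≤ a := by
  have ht : Filter.Tendsto (fun s : ℝ => a + s * c) (nhdsWithin 0 (Set.Ioi 0)) (nhds a) := by
    have : Continuous fun s : ℝ => a + s * c := by fun_prop
    simpa using (this.tendsto 0).mono_left nhdsWithin_le_nhds
  refine ge_of_tendsto ht ?_
  filter_upwards [Ioc_mem_nhdsGT (zero_lt_one' ℝ)] with s hs using h s hs.1 hs.2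

/-- Directional derivative of the averaged exponential loss. -/
theorem inner_gradient_expLoss {τ : ℝ} (hτ : τ ≠ 0) {n p : ℕ}
    (x : Fin n → EuclideanSpace ℝ (Fin p)) (y : Fin n → ℝ) (b d : EuclideanSpace ℝ (Fin p)) :
    ⟪gradient (fun β : EuclideanSpace ℝ (Fin p) => (1 / (n : ℝ)) * ∑ i, (1 / τ) *
        (1 - Real.exp (-(τ * (y i - ∑ j, x i j * β j) ^ 2 / 2)))) b, d⟫ =
      -((1 / (n : ℝ)) * ∑ i, Real.exp (-(τ / 2) * (y i - ∑ j, x i j * b j) ^ 2) *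
        ((y i - ∑ j, x i j * b j) * ∑ j, x i j * d j)) := by
  set L := fun β : EuclideanSpace ℝ (Fin p) => (1 / (n : ℝ)) * ∑ i, (1 / τ) *
        (1 - Real.exp (-(τ * (y i - ∑ j, x i j * β j) ^ 2 / 2))) with hL
  have hdiff : Differentiable ℝ L := by
    rw [hL]
    fun_prop
  have hgrad : ⟪gradient L b, d⟫ = fderiv ℝ L b d := by
    simp [gradient]
  rw [hgrad]
  have hline : HasDerivAt (fun s : ℝ => L (b + s • d)) (fderiv ℝ L b d) 0 := by
    have hpath : HasDerivAt (fun s : ℝ => b + s • d) d 0 := by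
      simpa using ((hasDerivAt_id (0 : ℝ)).smul_const d).const_add b
    have hfd : HasFDerivAt L (fderiv ℝ L b) (b + (0 : ℝ) • d) := by
      simpa using (hdiff b).hasFDerivAt
    exact hfd.comp_hasDerivAt (0 : ℝ) hpath
  refine hline.unique ?_
  have hres (i : Fin n) (s : ℝ) : y i - ∑ j, x i j * (b + s • d) j =
      (y i - ∑ j, x i j * b j) - s * ∑ j, x i j * d j := by
    simp only [PiLp.add_apply, PiLp.smul_apply, smul_eq_mul, mul_add, Finset.sum_add_distrib,
      Finset.mul_sum, mul_left_comm s]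
    ring
  simp only [hL, hres]
  rw [← mul_neg, ← Finset.sum_neg_distrib]
  refine HasDerivAt.const_mul _ (HasDerivAt.fun_sum fun i _ => ?_)
  generalize y i - ∑ j, x i j * b j = r
  generalize ∑ j, x i j * d j = a
  have hlin : HasDerivAt (fun s : ℝ => r - s * a) (-a) 0 := by
    simpa using ((hasDerivAt_id (0 : ℝ)).mul_const a).const_sub r
  refine (((((hlin.fun_pow 2).const_mul τ).div_const 2).fun_neg.exp.const_sub 1).const_mul
    (1 / τ)).congr_deriv ?_
  rw [zero_mul, sub_zero]
  rw [show -(τ * r ^ 2 / 2) = -(τ / 2) * r ^ 2 by ring]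
  field_simp
  norm_num

/-- Every limit point `β*` of the MM iterates (each `β^{(t+1)}` exactly minimizing
the weighted-Lasso surrogate `Q^{(t)}`) is a stationary point of
`F = L + λ‖·‖₁` in the subgradient sense: `0 ∈ ∇L(β*) + λ∂‖β*‖₁`, i.e.
`−∇L(β*)` is a subgradient of the convex function `β ↦ λ‖β‖₁` at `β*`. -/
theorem mm_cluster_points_stationary (τ lam : ℝ) (hτ : 0 < τ) (hlam : 0 ≤ lam)
    (n p : ℕ) (hn : 0 < n)
    (x : Fin n → EuclideanSpace ℝ (Fin p)) (y : Fin n → ℝ)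
    (L : EuclideanSpace ℝ (Fin p) → ℝ)
    (hL : L = fun β : EuclideanSpace ℝ (Fin p) =>
      (1 / (n : ℝ)) * ∑ i, (1 / τ) *
        (1 - Real.exp (-(τ * (y i - ∑ j, x i j * β j) ^ 2 / 2))))
    (B : ℕ → EuclideanSpace ℝ (Fin p))
    (hmm : ∀ t : ℕ, IsMinOn
      (fun β : EuclideanSpace ℝ (Fin p) =>
        (1 / (2 * (n : ℝ))) * ∑ i,
            Real.exp (-(τ / 2) * (y i - ∑ j, x i j * B t j) ^ 2) *
              (y i - ∑ j, x i j * β j) ^ 2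
          + lam * ∑ j, |β j|)
      Set.univ (B (t + 1)))
    (βstar : EuclideanSpace ℝ (Fin p))
    (hcluster : MapClusterPt βstar Filter.atTop B) :
    ∀ β : EuclideanSpace ℝ (Fin p),
      lam * (∑ j, |β j|) ≥
        lam * (∑ j, |βstar j|) + ⟪-(gradient L βstar), β - βstar⟫ := by
  intro β
  set R := fun (i : Fin n) (b : EuclideanSpace ℝ (Fin p)) => y i - ∑ j, x i j * b j with hR
  set N := fun b : EuclideanSpace ℝ (Fin p) => ∑ j, |b j| with hN
  set V := fun (i : Fin n) (b : EuclideanSpace ℝ (Fin p)) =>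
    Real.exp (-(τ / 2) * R i b ^ 2) with hV
  have hn' : (0 : ℝ) < n := by exact_mod_cast hn
  have hLc : Continuous L := by
    rw [hL]
    fun_prop
  have hle (z : EuclideanSpace ℝ (Fin p)) : L βstar + lam * N βstar ≤
      L βstar + (1 / (2 * (n : ℝ))) * ∑ i, V i βstar * (R i z ^ 2 - R i βstar ^ 2) +
        lam * N z := by
    refine MapClusterPt.le_majorizer (F := fun b => L b + lam * N b)
      (G := fun b z => L b + (1 / (2 * (n : ℝ))) * ∑ i, V i b * (R i z ^ 2 - R i b ^ 2) +
        lam * N z) (by fun_prop) (fun z => by fun_prop) (fun b z => ?_) (fun b => by simp)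
      (fun t z => ?_) hcluster z
    · have hsum := mul_le_mul_of_nonneg_left (Finset.sum_le_sum fun i (_ : i ∈ Finset.univ) =>
        expLoss_le_tangent hτ (R i z) (R i b)) (one_div_pos.2 hn').le
      have hhalf : 1 / (2 * (n : ℝ)) = 1 / n * (1 / 2) := by field_simp
      simp only [Finset.sum_add_distrib, ← Finset.mul_sum] at hsum
      simp only [hL, hV, hhalf, ← Finset.mul_sum]
      linarith
    · have h := hmm t (Set.mem_univ z)
      simp only [Set.mem_ofPred_eq] at h
      simp only [mul_sub, Finset.sum_sub_distrib]
      simp only [hV, hR, hN]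
      linarith
  have hinner := inner_gradient_expLoss hτ.ne' x y βstar (β - βstar)
  rw [← hL] at hinner
  rw [inner_neg_left, hinner]
  set a := fun i => ∑ j, x i j * (β - βstar) j with ha
  have hres (i : Fin n) (s : ℝ) : R i (βstar + s • (β - βstar)) = R i βstar - s * a i := by
    simp only [hR, ha, PiLp.add_apply, PiLp.smul_apply, smul_eq_mul, mul_add,
      Finset.sum_add_distrib, Finset.mul_sum, mul_left_comm s]
    ring
  have hnorm (s : ℝ) (hs : 0 < s) (hs1 : s ≤ 1) :
      N (βstar + s • (β - βstar)) ≤ N βstar + s * (N β - N βstar) := by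
    have hsplit : N βstar + s * (N β - N βstar) = ∑ j, ((1 - s) * |βstar j| + s * |β j|) := by
      simp only [hN, Finset.sum_add_distrib, ← Finset.mul_sum]
      ring
    rw [hsplit]
    refine Finset.sum_le_sum fun j _ => ?_
    have hj : (βstar + s • (β - βstar)) j = (1 - s) * βstar j + s * β j := by
      simp only [PiLp.add_apply, PiLp.smul_apply, PiLp.sub_apply, smul_eq_mul]
      ring
    rw [hj]
    refine (abs_add_le _ _).trans_eq ?_
    rw [abs_mul, abs_mul, abs_of_nonneg (sub_nonneg.2 hs1), abs_of_pos hs]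
  have hquad (s : ℝ) : (1 / (2 * (n : ℝ))) *
      ∑ i, V i βstar * (R i (βstar + s • (β - βstar)) ^ 2 - R i βstar ^ 2) =
        s * (-((1 / (n : ℝ)) * ∑ i, V i βstar * (R i βstar * a i)) +
          s * ((1 / (2 * (n : ℝ))) * ∑ i, V i βstar * a i ^ 2)) := by
    have hterm (i : Fin n) :
        V i βstar * (R i (βstar + s • (β - βstar)) ^ 2 - R i βstar ^ 2) =
          -(2 * s) * (V i βstar * (R i βstar * a i)) + s ^ 2 * (V i βstar * a i ^ 2) := by
      rw [hres]
      ring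
    simp only [hterm, Finset.sum_add_distrib, ← Finset.mul_sum]
    field_simp
  have key : 0 ≤ -((1 / (n : ℝ)) * ∑ i, V i βstar * (R i βstar * a i)) +
      lam * (N β - N βstar) := by
    refine nonneg_of_forall_add_mul_nonneg
      (c := (1 / (2 * (n : ℝ))) * ∑ i, V i βstar * a i ^ 2) fun s hs hs1 => ?_
    have h1 := hle (βstar + s • (β - βstar))
    rw [hquad] at h1
    have h2 := mul_le_mul_of_nonneg_left (hnorm s hs hs1) hlam
    refine nonneg_of_mul_nonneg_right ?_ hs
    linarith
  linarith
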